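/- arXiv:2307.03590 — 2 statements merged into one kernel-verified Lean document; each statement's English description precedes it below -/
import Mathlib

section
/- If A ∈ ℝ^{n×n} is Hurwitz, then the n² × n² real matrix Iₙ ⊗ Aᵀ + Aᵀ ⊗ Iₙ is invertible. -/
open Matrix Kronecker

noncomputable section

/-- A real square matrix is Hurwitz if every complex eigenvalue has strictly
negative real part. -/
def IsHurwitz {n : ℕ} (M : Matrix (Fin n) (Fin n) ℝ) : Prop :=
  ∀ μ ∈ spectrum ℂ (M.map (algebraMap ℝ ℂ)), μ.re < 0

namespace Matrix

/-- A matrix intertwining two square matrices intertwines every polynomial in them. -/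
theorem aeval_mul_eq_mul_aeval {R m n : Type*} [CommRing R] [Fintype m] [DecidableEq m]
    [Fintype n] [DecidableEq n] {M : Matrix m m R} {N : Matrix n n R} {X : Matrix m n R}
    (h : M * X = X * N) (p : Polynomial R) :
    Polynomial.aeval M p * X = X * Polynomial.aeval N p := by
  induction p using Polynomial.induction_on with
  | C a => simp [Algebra.algebraMap_eq_smul_one]
  | add p q hp hq => simp [Matrix.add_mul, Matrix.mul_add, hp, hq]
  | monomial k a ih =>
    rw [pow_succ, ← mul_assoc, map_mul _ _ Polynomial.X, map_mul _ _ Polynomial.X,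
      Polynomial.aeval_X, Polynomial.aeval_X, Matrix.mul_assoc, h, ← Matrix.mul_assoc, ih,
      Matrix.mul_assoc]

/-- Over an algebraically closed field, a matrix intertwining two square matrices with disjoint
spectra vanishes. -/
theorem eq_zero_of_mul_eq_mul_of_disjoint_spectrum {K m n : Type*} [Field K] [IsAlgClosed K]
    [Fintype m] [DecidableEq m] [Fintype n] [DecidableEq n] {M : Matrix m m K}
    {N : Matrix n n K} {X : Matrix m n K} (hd : Disjoint (spectrum K M) (spectrum K N))
    (h : M * X = X * N) : X = 0 := by
  cases isEmpty_or_nonempty m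
  · exact Subsingleton.elim _ _
  have hu : IsUnit (Polynomial.aeval M N.charpoly) := by
    rw [← spectrum.zero_notMem_iff K, spectrum.map_polynomial_aeval_of_nonempty _ _
      (spectrum.nonempty_of_isAlgClosed_of_finiteDimensional K M)]
    rintro ⟨k, hkM, hk⟩
    exact Set.disjoint_left.mp hd hkM (mem_spectrum_iff_isRoot_charpoly.mpr hk)
  have h0 : Polynomial.aeval M N.charpoly * X = 0 := by
    rw [aeval_mul_eq_mul_aeval h, aeval_self_charpoly, Matrix.mul_zero]
  rw [← nonsing_inv_mul_cancel_left _ X ((isUnit_iff_isUnit_det _).mp hu), h0, Matrix.mul_zero]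

end Matrix

theorem kronecker_sum_invertible_of_hurwitz
    {n : ℕ} (A : Matrix (Fin n) (Fin n) ℝ) (hA : IsHurwitz A) :
    IsUnit ((1 : Matrix (Fin n) (Fin n) ℝ) ⊗ₖ Aᵀ + Aᵀ ⊗ₖ (1 : Matrix (Fin n) (Fin n) ℝ)) := by
  rw [← mulVec_injective_iff_isUnit, ← coe_mulVecLin, injective_iff_map_eq_zero]
  intro v hv
  obtain ⟨X, rfl⟩ := vec_bijective.surjective v
  rw [mulVecLin_apply, add_mulVec, kronecker_mulVec_vec, kronecker_mulVec_vec, ← vec_add,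
    vec_eq_zero_iff, transpose_one, transpose_transpose, Matrix.mul_one, Matrix.one_mul] at hv
  set B := A.map (algebraMap ℝ ℂ)
  have hX : Bᵀ * X.map (algebraMap ℝ ℂ) = X.map (algebraMap ℝ ℂ) * -B := by
    rw [Matrix.mul_neg, ← transpose_map, ← Matrix.map_mul, ← Matrix.map_mul,
      eq_neg_of_add_eq_zero_left hv]
    ext
    simp
  have hd : Disjoint (spectrum ℂ Bᵀ) (spectrum ℂ (-B)) := by
    refine Set.disjoint_left.mpr fun μ h₁ h₂ => ?_
    rw [mem_spectrum_iff_isRoot_charpoly, charpoly_transpose,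
      ← mem_spectrum_iff_isRoot_charpoly] at h₁
    rw [← spectrum.neg_eq, Set.mem_neg] at h₂
    have hneg := hA _ h₂
    rw [Complex.neg_re] at hneg
    linarith [hA _ h₁]
  rw [vec_eq_zero_iff]
  exact map_injective (algebraMap ℝ ℂ).injective
    ((eq_zero_of_mul_eq_mul_of_disjoint_spectrum hd hX).trans (by simp))
end
end

section
/- Let U ⊆ ℝ^{m×r} be open and let X : U → ℝ^{n×n} be differentiable at K ∈ U and satisfy, for every K′ in a neighborhood of K, the Lyapunov equation A_{K′}ᵀ·X(K′) + X(K′)·A_{K′} + CᵀK′ᵀRK′C + Q = 0 where A_{K′} = A − BK′C. Then for every direction E ∈ ℝ^{m×r}, the directional derivative D = (derivative of X at K)(E) satisfies A_Kᵀ·D + D·A_K − (BEC)ᵀ·X(K) − X(K)·(BEC) + CᵀEᵀRKC + CᵀKᵀREC = 0. -/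
open Matrix Filter

attribute [local instance] Matrix.normedAddCommGroup Matrix.normedSpace

noncomputable section

/-- The product rule for matrix products along a curve. -/
theorem hasDerivAt_matrix_mul {ι κ ν : Type*} [Fintype ι] [Fintype κ] [Fintype ν]
    {F : ℝ → Matrix ι κ ℝ} {G : ℝ → Matrix κ ν ℝ} {F' : Matrix ι κ ℝ} {G' : Matrix κ ν ℝ} {t : ℝ}
    (hF : HasDerivAt F F' t) (hG : HasDerivAt G G' t) :
    HasDerivAt (fun s => F s * G s) (F' * G t + F t * G') t := by
  refine hasDerivAt_pi.2 fun i => hasDerivAt_pi.2 fun j => ?_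
  have h := HasDerivAt.fun_sum (u := Finset.univ) fun k _ =>
    (hasDerivAt_pi.1 (hasDerivAt_pi.1 hF i) k).mul (hasDerivAt_pi.1 (hasDerivAt_pi.1 hG k) j)
  simpa [Matrix.mul_apply, Finset.sum_add_distrib] using h

/-- Transposition commutes with differentiation along a curve. -/
theorem hasDerivAt_matrix_transpose {ι κ : Type*} [Fintype ι] [Fintype κ]
    {F : ℝ → Matrix ι κ ℝ} {F' : Matrix ι κ ℝ} {t : ℝ} (hF : HasDerivAt F F' t) :
    HasDerivAt (fun s => (F s)ᵀ) F'ᵀ t :=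
  hasDerivAt_pi.2 fun i => hasDerivAt_pi.2 fun j => hasDerivAt_pi.1 (hasDerivAt_pi.1 hF j) i

theorem lyapunov_solution_directional_derivative
    {n m r : ℕ} (A : Matrix (Fin n) (Fin n) ℝ) (B : Matrix (Fin n) (Fin m) ℝ)
    (C : Matrix (Fin r) (Fin n) ℝ) (Q : Matrix (Fin n) (Fin n) ℝ)
    (R : Matrix (Fin m) (Fin m) ℝ) (hQ : Q.IsSymm) (hR : R.IsSymm)
    (U : Set (Matrix (Fin m) (Fin r) ℝ)) (hU : IsOpen U)
    (X : Matrix (Fin m) (Fin r) ℝ → Matrix (Fin n) (Fin n) ℝ)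
    (K : Matrix (Fin m) (Fin r) ℝ) (hKU : K ∈ U)
    (hdiff : DifferentiableAt ℝ X K)
    (hlyap : ∀ᶠ K' in nhds K,
      (A - B*K'*C)ᵀ * X K' + X K' * (A - B*K'*C) + Cᵀ*K'ᵀ*R*K'*C + Q = 0) :
    ∀ E : Matrix (Fin m) (Fin r) ℝ,
      (A - B*K*C)ᵀ * (fderiv ℝ X K E) + (fderiv ℝ X K E) * (A - B*K*C)
        - (B*E*C)ᵀ * X K - X K * (B*E*C) + Cᵀ*Eᵀ*R*K*C + Cᵀ*Kᵀ*R*E*C = 0 := by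
  intro E
  have hγ : HasDerivAt (fun t : ℝ => K + t • E) E 0 := by
    have h := ((hasDerivAt_id (0 : ℝ)).smul_const E).const_add K
    rw [one_smul] at h
    exact h
  have hγ0 : K = K + (0 : ℝ) • E := by simp
  have hX : HasDerivAt (fun t : ℝ => X (K + t • E)) (fderiv ℝ X K E) 0 :=
    hdiff.hasFDerivAt.comp_hasDerivAt_of_eq 0 hγ hγ0
  have hc {a b : ℕ} (M : Matrix (Fin a) (Fin b) ℝ) : HasDerivAt (fun _ : ℝ => M) 0 0 :=
    hasDerivAt_const 0 M
  have hA := (hc A).sub (hasDerivAt_matrix_mul (hasDerivAt_matrix_mul (hc B) hγ) (hc C))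
  have hq := hasDerivAt_matrix_mul (hasDerivAt_matrix_mul (hasDerivAt_matrix_mul
    (hasDerivAt_matrix_mul (hc Cᵀ) (hasDerivAt_matrix_transpose hγ)) (hc R)) hγ) (hc C)
  have hL := (((hasDerivAt_matrix_mul (hasDerivAt_matrix_transpose hA) hX).add
    (hasDerivAt_matrix_mul hX hA)).add hq).add (hc Q)
  have hcont : Tendsto (fun t : ℝ => K + t • E) (nhds 0) (nhds K) := by
    have h := hγ.continuousAt.tendsto
    simp only [zero_smul, add_zero] at h
    exact h
  have hD := hL.unique ((hc (0 : Matrix (Fin n) (Fin n) ℝ)).congr_of_eventuallyEq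
    (hcont.eventually hlyap))
  simp only [zero_smul, add_zero, Matrix.zero_mul, Matrix.mul_zero,
    zero_add, zero_sub, Pi.sub_apply, Matrix.transpose_neg, Matrix.neg_mul, Matrix.mul_neg,
    Matrix.add_mul] at hD
  rw [← hD]
  abel
end
end
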